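/- For each d ∈ ℤ_+, each ξ ∈ 𝕋^d and each t > 0 one has | F_{ℤ^d} g_t(ξ) − 1 | ≤ 6πt|ξ|². -/

import Mathlib

open scoped ENNReal Real BigOperators
open Real

/-- The one-dimensional Theta function `θ_t(ζ) = Σ_{k∈ℤ} exp(-π(k-ζ)²t)`. -/
noncomputable def theta (t ζ : ℝ) : ℝ :=
  ∑' k : ℤ, Real.exp (-π * ((k : ℝ) - ζ) ^ 2 * t)

/-- The d-dimensional Theta function `Θ_t(ξ) = Π_j θ_t(ξ_j)`. -/
noncomputable def bigTheta (d : ℕ) (t : ℝ) (ξ : Fin d → ℝ) : ℝ :=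
  ∏ j, theta t (ξ j)

/-- The discrete normalized Gaussian kernel `g_t(n) = Θ_{1/t}(0)⁻¹ exp(-π|n|²/t)`. -/
noncomputable def gauss (d : ℕ) (t : ℝ) (n : Fin d → ℤ) : ℝ :=
  (bigTheta d (1 / t) 0)⁻¹ * Real.exp (-π * (∑ j, ((n j : ℝ)) ^ 2) / t)

/-- The convolution operator `G_t f(x) = Σ_n g_t(n) f(x-n)` on ℤ^d. -/
noncomputable def gConv (d : ℕ) (t : ℝ) (f : (Fin d → ℤ) → ℂ) (x : Fin d → ℤ) : ℂ :=
  ∑' n : Fin d → ℤ, (gauss d t n : ℂ) * f (x - n)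

/-- The ℓ^p norm (valued in ℝ≥0∞) of an ℝ≥0∞-valued function on ℤ^d. -/
noncomputable def lpNorm (d : ℕ) (p : ℝ) (F : (Fin d → ℤ) → ℝ≥0∞) : ℝ≥0∞ :=
  (∑' x : Fin d → ℤ, F x ^ p) ^ (1 / p)

/-- The Fourier transform of the discrete Gaussian kernel,
`F_{ℤ^d} g_t(ξ) = Σ_{n∈ℤ^d} g_t(n) e^{2πi n·ξ}`. -/
noncomputable def fourierGauss (d : ℕ) (t : ℝ) (ξ : Fin d → ℝ) : ℂ :=
  ∑' n : Fin d → ℤ, (gauss d t n : ℂ) *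
    Complex.exp (2 * (π : ℂ) * Complex.I * ∑ j, (n j : ℂ) * (ξ j : ℂ))

lemma aux_summable (t ζ : ℝ) (ht : 0 < t) :
    Summable fun k : ℤ => Real.exp (-π * ((k : ℝ) - ζ) ^ 2 * t) := by
  have h := ((summable_jacobiTheta₂_term_iff (-(Complex.I * ζ * t)) (Complex.I * t)).2
    (by simpa using ht)).norm.mul_left (Real.exp (-π * ζ ^ 2 * t))
  refine h.congr fun k => ?_
  rw [norm_jacobiTheta₂_term, ← Real.exp_add]
  congr 1
  simp
  ring

lemma aux_theta_neg (t ζ : ℝ) : theta t (-ζ) = theta t ζ := by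
  unfold theta
  rw [← (Equiv.neg ℤ).tsum_eq]
  refine tsum_congr fun k => ?_
  congr 1
  simp
  left
  ring

lemma aux_theta_pos (t ζ : ℝ) (ht : 0 < t) : 0 < theta t ζ :=
  (aux_summable t ζ ht).tsum_pos (fun _ => (Real.exp_pos _).le) 0 (Real.exp_pos _)

lemma aux_lower (t ζ : ℝ) (ht : 0 < t) :
    Real.exp (-π * ζ ^ 2 * t) * theta t 0 ≤ theta t ζ := by
  have h : 2 * (Real.exp (-π * ζ ^ 2 * t) * theta t 0) ≤ theta t ζ + theta t (-ζ) := by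
    unfold theta
    rw [← (aux_summable t ζ ht).tsum_add (aux_summable t (-ζ) ht), ← tsum_mul_left,
      ← tsum_mul_left]
    refine Summable.tsum_le_tsum (fun k => ?_)
      (((aux_summable t 0 ht).mul_left _).mul_left _)
      ((aux_summable t ζ ht).add (aux_summable t (-ζ) ht))
    have e1 : Real.exp (-π * ((k : ℝ) - ζ) ^ 2 * t) =
        Real.exp (-π * ζ ^ 2 * t) * Real.exp (-π * ((k : ℝ) - 0) ^ 2 * t) *
          Real.exp (2 * π * k * ζ * t) := by
      rw [← Real.exp_add, ← Real.exp_add]; congr 1; ring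
    have e2 : Real.exp (-π * ((k : ℝ) - -ζ) ^ 2 * t) =
        Real.exp (-π * ζ ^ 2 * t) * Real.exp (-π * ((k : ℝ) - 0) ^ 2 * t) *
          Real.exp (-(2 * π * k * ζ * t)) := by
      rw [← Real.exp_add, ← Real.exp_add]; congr 1; ring
    rw [e1, e2, ← mul_add, mul_comm 2]
    refine mul_le_mul_of_nonneg_left ?_ (by positivity)
    have := Real.one_le_cosh (2 * π * k * ζ * t)
    rw [Real.cosh_eq] at this
    linarith
  rw [aux_theta_neg] at h
  linarith

/-- One-dimensional summand. -/
noncomputable def auxTerm (t ζ : ℝ) (n : ℤ) : ℂ :=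
  (Real.exp (-π * (n : ℝ) ^ 2 / t) : ℂ) * Complex.exp (2 * (π : ℂ) * Complex.I * (n * ζ))

lemma aux_norm_term (t ζ : ℝ) (n : ℤ) :
    ‖auxTerm t ζ n‖ = Real.exp (-π * ((n : ℝ) - 0) ^ 2 * (1 / t)) := by
  have : (2 * (π : ℂ) * Complex.I * (n * ζ)) = ((2 * π * n * ζ : ℝ) : ℂ) * Complex.I := by
    push_cast; ring
  rw [auxTerm, norm_mul, this, Complex.norm_exp_ofReal_mul_I, mul_one, Complex.norm_real,
    Real.norm_of_nonneg (Real.exp_pos _).le]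
  congr 1; ring

lemma aux_term_summable (t ζ : ℝ) (ht : 0 < t) : Summable fun n => ‖auxTerm t ζ n‖ := by
  simp_rw [aux_norm_term]
  exact aux_summable (1 / t) 0 (by positivity)

lemma aux_poisson (t ζ : ℝ) (ht : 0 < t) :
    ∑' n, auxTerm t ζ n = (((1 / (1 / t) ^ (1 / 2 : ℝ)) * theta t ζ : ℝ) : ℂ) := by
  have h := Complex.tsum_exp_neg_quadratic (a := ((1 / t : ℝ) : ℂ))
    (by rw [Complex.ofReal_re]; positivity) (Complex.I * ζ)
  have htc : (t : ℂ) ≠ 0 := by exact_mod_cast ht.ne'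
  calc _ = _ := tsum_congr fun n => ?_
    _ = _ := h
    _ = _ := ?_
  · rw [auxTerm, Complex.ofReal_exp, ← Complex.exp_add]
    congr 1; push_cast; ring
  · rw [theta, Complex.ofReal_mul, Complex.ofReal_tsum,
      Complex.ofReal_div 1 ((1 / t) ^ (1 / 2 : ℝ)), Complex.ofReal_cpow (by positivity)]
    push_cast
    congr 1
    refine tsum_congr fun n => ?_
    congr 1
    have : (n : ℂ) + Complex.I * (Complex.I * ζ) = n - ζ := by
      rw [← mul_assoc, Complex.I_mul_I]; ring
    rw [this]
    field_simp

lemma aux_zero (t : ℝ) : ∑' n, auxTerm t 0 n = (theta (1 / t) 0 : ℂ) := by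
  rw [theta, Complex.ofReal_tsum]
  refine tsum_congr fun n => ?_
  simp [auxTerm]
  congr 1
  ring

lemma aux_ratio (t ζ : ℝ) (ht : 0 < t) : ∃ r : ℝ,
    (theta (1 / t) 0 : ℂ)⁻¹ * ∑' n, auxTerm t ζ n = r ∧ Real.exp (-π * ζ ^ 2 * t) ≤ r ∧ r ≤ 1 := by
  have h0 : theta (1 / t) 0 = (1 / (1 / t) ^ (1 / 2 : ℝ)) * theta t 0 := by
    have := (aux_zero t).symm.trans (aux_poisson t 0 ht)
    exact_mod_cast this
  have hc : 0 < 1 / (1 / t) ^ (1 / 2 : ℝ) := by positivity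
  have hp0 := aux_theta_pos (1 / t) 0 (by positivity)
  have hle := norm_tsum_le_tsum_norm (aux_term_summable t ζ ht)
  rw [aux_poisson t ζ ht] at hle
  simp_rw [aux_norm_term] at hle
  rw [Complex.norm_real] at hle
  have hle' := (le_abs_self _).trans hle
  refine ⟨(theta (1 / t) 0)⁻¹ * ((1 / (1 / t) ^ (1 / 2 : ℝ)) * theta t ζ), ?_, ?_, ?_⟩
  · rw [aux_poisson t ζ ht]; push_cast; rfl
  · rw [← div_eq_inv_mul, le_div_iff₀ hp0, h0]
    nlinarith [mul_le_mul_of_nonneg_left (aux_lower t ζ ht) hc.le]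
  · rw [← div_eq_inv_mul, div_le_one hp0]
    exact hle'

lemma aux_prod (d : ℕ) (f : Fin d → ℤ → ℂ) (hf : ∀ j, Summable fun n => ‖f j n‖) :
    (Summable fun n : Fin d → ℤ => ‖∏ j, f j (n j)‖) ∧
      ∑' n : Fin d → ℤ, ∏ j, f j (n j) = ∏ j, ∑' n, f j n := by
  induction d with
  | zero => exact ⟨(hasSum_fintype _).summable, by simp⟩
  | succ d ih =>
    obtain ⟨h1, h2⟩ := ih (fun j => f j.succ) (fun j => hf _)
    constructor
    · rw [← (Fin.consEquiv fun _ => ℤ).summable_iff]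
      refine (Summable.mul_norm (hf 0) h1).congr fun p => ?_
      simp [Fin.consEquiv, Fin.prod_univ_succ]
    · rw [Fin.prod_univ_succ, ← h2, tsum_mul_tsum_of_summable_norm (hf 0) h1,
        ← (Fin.consEquiv fun _ => ℤ).tsum_eq]
      refine tsum_congr fun p => ?_
      simp [Fin.consEquiv, Fin.prod_univ_succ]

lemma aux_fourier (d : ℕ) (t : ℝ) (ht : 0 < t) (ξ : Fin d → ℝ) :
    fourierGauss d t ξ = ∏ j, ((theta (1 / t) 0 : ℂ)⁻¹ * ∑' n, auxTerm t (ξ j) n) := by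
  rw [Finset.prod_mul_distrib,
    ← (aux_prod d (fun j => auxTerm t (ξ j)) fun j => aux_term_summable t _ ht).2,
    ← tsum_mul_left, fourierGauss]
  refine tsum_congr fun n => ?_
  have e : ((Real.exp (-π * (∑ j, ((n j : ℝ)) ^ 2) / t) : ℝ) : ℂ) =
      ∏ j, ((Real.exp (-π * (n j : ℝ) ^ 2 / t) : ℝ) : ℂ) := by
    rw [← Complex.ofReal_prod, ← Real.exp_sum, Finset.mul_sum, Finset.sum_div]
  simp only [auxTerm]
  rw [gauss, Finset.prod_mul_distrib, Complex.ofReal_mul, e, mul_assoc, Finset.mul_sum,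
    Complex.exp_sum]
  congr 1
  simp [bigTheta]

/-- Estimate at the origin: `|F_{ℤ^d} g_t(ξ) - 1| ≤ 6πt|ξ|²` for all `d ∈ ℤ_+`, `ξ ∈ 𝕋^d`
and `t > 0`. -/
theorem fourier_gauss_origin (d : ℕ) (hd : 0 < d) (ξ : Fin d → ℝ)
    (hξ : ∀ j, ξ j ∈ Set.Ico (-(1/2) : ℝ) (1/2)) (t : ℝ) (ht : 0 < t) :
    ‖fourierGauss d t ξ - 1‖ ≤ 6 * π * t * ∑ j, ξ j ^ 2 := by
  choose r hr1 hr2 hr3 using fun j => aux_ratio t (ξ j) ht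
  rw [aux_fourier d t ht, Finset.prod_congr rfl fun j _ => hr1 j, ← Complex.ofReal_prod,
    ← Complex.ofReal_one, ← Complex.ofReal_sub, Complex.norm_real, Real.norm_eq_abs]
  have hup : ∏ j, r j ≤ 1 :=
    Finset.prod_le_one (fun j _ => (Real.exp_pos _).le.trans (hr2 j)) fun j _ => hr3 j
  have hlo : Real.exp (∑ j, -π * ξ j ^ 2 * t) ≤ ∏ j, r j := by
    rw [Real.exp_sum]
    exact Finset.prod_le_prod (fun j _ => (Real.exp_pos _).le) fun j _ => hr2 j
  rw [← Finset.sum_mul, ← Finset.mul_sum] at hlo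
  have h1 := Real.add_one_le_exp (-π * (∑ j, ξ j ^ 2) * t)
  have hs : 0 ≤ ∑ j, ξ j ^ 2 := Finset.sum_nonneg fun j _ => sq_nonneg _
  have hq : 0 ≤ π * t * ∑ j, ξ j ^ 2 := by positivity
  rw [abs_le]
  constructor <;> nlinarith
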